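/- arXiv:1304.0704 — 2 statements merged into one kernel-verified Lean document; each statement's English description precedes it below -/
import Mathlib

section
/- (Invariance of the order interval under one monotone iteration step.) Assume: f : [0,T] × Ω̄ × ℝ → ℝ is continuous and continuously differentiable in its last argument; g₀ : [0,T] × Ω̄ × [0,T] × ℝ × ℝ → ℝ is continuous, continuously differentiable in (η₁, η₂), and nondecreasing in η₂; û, ũ ∈ C([0,T] × Ω̄) are of class C^{1,2} on D with û ≤ ũ on [0,T] × Ω̄, ũ_t − Lũ ≥ f(t,x,ũ) + ∫₀ᵗ g₀(t,x,s,ũ(t,x),ũ(s,x)) ds and û_t − Lû ≤ f(t,x,û) + ∫₀ᵗ g₀(t,x,s,û(t,x),û(s,x)) ds in D. Let c : [0,T] × Ω̄ → ℝ be continuous and bounded with c(t,x) ≥ −∂f/∂u(t,x,η) + ∫₀ᵗ max(0, −∂g₀/∂η₁(t,x,s,η₁,η₂)) ds whenever η, η₁, η₂ ∈ [û, ũ] pointwise, and define F₁(t,x,v) = c(t,x) v(t,x) + f(t,x,v(t,x)) + ∫₀ᵗ g₀(t,x,s,v(t,x),v(s,x)) ds for v ∈ C([0,T] × Ω̄).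 If v ∈ C([0,T] × Ω̄) satisfies û ≤ v ≤ ũ on [0,T] × Ω̄, and u ∈ C([0,T] × Ω̄) is of class C^{1,2} on D and satisfies ∂u/∂t − Lu + c u = F₁(t,x,v) in D, û ≤ u ≤ ũ on [0,T] × ∂Ω, and û(0,·) ≤ u(0,·) ≤ ũ(0,·) on Ω̄, then û ≤ u ≤ ũ on [0,T] × Ω̄. -/
open Set

/-- Partial derivative in time: `∂w/∂t (t, x)`. -/
noncomputable def ptime {N : ℕ} (w : ℝ × (Fin N → ℝ) → ℝ) (p : ℝ × (Fin N → ℝ)) : ℝ :=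
  deriv (fun t => w (t, p.2)) p.1

/-- First spatial partial derivative: `∂w/∂x_j (t, x)`. -/
noncomputable def pspace {N : ℕ} (j : Fin N) (w : ℝ × (Fin N → ℝ) → ℝ)
    (p : ℝ × (Fin N → ℝ)) : ℝ :=
  fderiv ℝ (fun x => w (p.1, x)) p.2 (Pi.single j 1)

/-- Second spatial partial derivative: `∂²w/∂x_i∂x_j (t, x)`. -/
noncomputable def pspace2 {N : ℕ} (i j : Fin N) (w : ℝ × (Fin N → ℝ) → ℝ)
    (p : ℝ × (Fin N → ℝ)) : ℝ :=
  fderiv ℝ (fun x => fderiv ℝ (fun y => w (p.1, y)) x (Pi.single j 1)) p.2 (Pi.single i 1)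

/-- The elliptic operator `L w = Σ_{i,j} a_{ij} ∂²w/∂x_i∂x_j + Σ_j b_j ∂w/∂x_j`. -/
noncomputable def Lop {N : ℕ} (a : Fin N → Fin N → ℝ × (Fin N → ℝ) → ℝ)
    (b : Fin N → ℝ × (Fin N → ℝ) → ℝ) (w : ℝ × (Fin N → ℝ) → ℝ)
    (p : ℝ × (Fin N → ℝ)) : ℝ :=
  (∑ i, ∑ j, a i j p * pspace2 i j w p) + ∑ j, b j p * pspace j w p

/-- `w` is of class `C^{1,2}` on `D`: once continuously differentiable in `t` and
twice continuously differentiable in `x` throughout `D`. -/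
def IsC12 {N : ℕ} (D : Set (ℝ × (Fin N → ℝ))) (w : ℝ × (Fin N → ℝ) → ℝ) : Prop :=
  (∀ p ∈ D, DifferentiableAt ℝ (fun t => w (t, p.2)) p.1) ∧
  ContinuousOn (ptime w) D ∧
  (∀ p ∈ D, ContDiffAt ℝ 2 (fun x => w (p.1, x)) p.2) ∧
  (∀ i j, ContinuousOn (pspace2 i j w) D)


/-- The Volterra integral term `∫₀ᵗ g₀(t, x, s, w(t,x), w(s,x)) ds` at `p = (t, x)`. -/
noncomputable def volterra {N : ℕ} (g₀ : ℝ × (Fin N → ℝ) → ℝ → ℝ → ℝ → ℝ)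
    (w : ℝ × (Fin N → ℝ) → ℝ) (p : ℝ × (Fin N → ℝ)) : ℝ :=
  ∫ s in (0:ℝ)..p.1, g₀ p s (w p) (w (s, p.2))

/-- The transformed right-hand side `F₁(t, x, v) = c v + f(t, x, v) + ∫₀ᵗ g₀ ds`. -/
noncomputable def F1 {N : ℕ} (c : ℝ × (Fin N → ℝ) → ℝ)
    (f : ℝ × (Fin N → ℝ) → ℝ → ℝ) (g₀ : ℝ × (Fin N → ℝ) → ℝ → ℝ → ℝ → ℝ)
    (v : ℝ × (Fin N → ℝ) → ℝ) (p : ℝ × (Fin N → ℝ)) : ℝ :=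
  c p * v p + f p (v p) + volterra g₀ v p

open Filter Topology

/-- At a local minimum the second derivative of a real function is nonnegative. -/
theorem IsLocalMin.deriv_deriv_nonneg {g : ℝ → ℝ} {x : ℝ} (h : IsLocalMin g x)
    (hc : ContinuousAt g x) : 0 ≤ deriv (deriv g) x := by
  by_contra! hneg
  have hmax := isLocalMax_of_deriv_deriv_neg hneg h.deriv_eq_zero hc
  have hconst : g =ᶠ[𝓝 x] fun _ => g x := by
    filter_upwards [h, hmax] with y h₁ h₂ using le_antisymm h₂ h₁
  have hderiv : deriv (deriv g) x = 0 := by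
    rw [hconst.deriv.deriv_eq]
    simp
  exact hneg.ne hderiv

/-- At a local minimum the second derivative of a `C²` function is a nonnegative quadratic form. -/
theorem IsLocalMin.fderiv_fderiv_nonneg {E : Type*} [NormedAddCommGroup E] [NormedSpace ℝ E]
    {w : E → ℝ} {x : E} (h : IsLocalMin w x) (hw : ContDiffAt ℝ 2 w x) (ξ : E) :
    0 ≤ fderiv ℝ (fderiv ℝ w) x ξ ξ := by
  have hline (r : ℝ) : HasDerivAt (fun r : ℝ => x + r • ξ) ξ r := by
    simpa using ((hasDerivAt_id r).smul_const ξ).const_add x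
  have htend : Tendsto (fun r : ℝ => x + r • ξ) (𝓝 0) (𝓝 x) := by
    simpa using (hline 0).continuousAt.tendsto
  have hdiff : ∀ᶠ y in 𝓝 x, DifferentiableAt ℝ w y :=
    (hw.eventually (by simp)).mono fun y hy => hy.differentiableAt (by norm_num)
  have hderiv : deriv (fun r : ℝ => w (x + r • ξ)) =ᶠ[𝓝 0] fun r => fderiv ℝ w (x + r • ξ) ξ := by
    filter_upwards [htend.eventually hdiff] with r hr
    exact (hr.hasFDerivAt.comp_hasDerivAt r (hline r)).deriv
  have hsecond : HasFDerivAt (fderiv ℝ w) (fderiv ℝ (fderiv ℝ w) x) (x + (0 : ℝ) • ξ) := by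
    simpa using ((hw.fderiv_right (m := 1) (by norm_num)).differentiableAt
      (by norm_num)).hasFDerivAt
  have hderiv2 : deriv (deriv fun r : ℝ => w (x + r • ξ)) 0 = fderiv ℝ (fderiv ℝ w) x ξ ξ := by
    rw [hderiv.deriv_eq]
    have hcomp : HasDerivAt (fun r : ℝ => fderiv ℝ w (x + r • ξ))
        (fderiv ℝ (fderiv ℝ w) x ξ) 0 := hsecond.comp_hasDerivAt 0 (hline 0)
    have happly := hcomp.clm_apply (hasDerivAt_const 0 ξ)
    rw [map_zero, add_zero] at happly
    exact happly.deriv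
  rw [← hderiv2]
  refine IsLocalMin.deriv_deriv_nonneg ?_ ?_
  · simpa [IsLocalMin, IsMinFilter] using htend.eventually h
  · have hcont : ContinuousAt w (x + (0 : ℝ) • ξ) := by simpa using hw.continuousAt
    exact hcont.comp (f := fun r : ℝ => x + r • ξ) (hline 0).continuousAt

open scoped MatrixOrder in
/-- The entrywise pairing of a positive semidefinite matrix with a nonnegative quadratic form is
nonnegative. -/
theorem Matrix.PosSemidef.sum_mul_nonneg {n : Type*} [Fintype n] {A H : Matrix n n ℝ}
    (hA : A.PosSemidef) (hH : ∀ ξ : n → ℝ, 0 ≤ ∑ i, ∑ j, ξ i * ξ j * H i j) :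
    0 ≤ ∑ i, ∑ j, A i j * H i j := by
  classical
  obtain ⟨B, rfl⟩ := CStarAlgebra.nonneg_iff_eq_star_mul_self.mp hA.nonneg
  have hsum : ∑ i, ∑ j, (star B * B) i j * H i j = ∑ k, ∑ i, ∑ j, B k i * B k j * H i j := by
    rw [Finset.sum_comm]
    simp_rw [Matrix.mul_apply, Matrix.star_apply, star_trivial, Finset.sum_mul]
    rw [Finset.sum_comm]
    refine (Finset.sum_congr rfl fun i _ => Finset.sum_comm).trans Finset.sum_comm
  rw [hsum]
  exact Finset.sum_nonneg fun k _ => hH (B k)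

theorem pspace2_eq_fderiv_fderiv {N : ℕ} (i j : Fin N) {w : ℝ × (Fin N → ℝ) → ℝ}
    {p : ℝ × (Fin N → ℝ)} (hw : ContDiffAt ℝ 2 (fun x => w (p.1, x)) p.2) :
    pspace2 i j w p =
      fderiv ℝ (fderiv ℝ fun x => w (p.1, x)) p.2 (Pi.single i 1) (Pi.single j 1) := by
  have hd : DifferentiableAt ℝ (fderiv ℝ fun x => w (p.1, x)) p.2 :=
    (hw.fderiv_right (m := 1) (by norm_num)).differentiableAt (by norm_num)
  rw [pspace2, fderiv_clm_apply hd (by fun_prop)]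
  simp

/-- If `u₁ - u₂` has a spatial local minimum at `p`, then `L u₂ ≤ L u₁` at `p`. -/
theorem Lop_le_of_isLocalMin {N : ℕ} {a : Fin N → Fin N → ℝ × (Fin N → ℝ) → ℝ}
    {b : Fin N → ℝ × (Fin N → ℝ) → ℝ} {u₁ u₂ : ℝ × (Fin N → ℝ) → ℝ} {p : ℝ × (Fin N → ℝ)}
    (ha : (Matrix.of fun i j => a i j p).PosSemidef)
    (h₁ : ContDiffAt ℝ 2 (fun x => u₁ (p.1, x)) p.2)
    (h₂ : ContDiffAt ℝ 2 (fun x => u₂ (p.1, x)) p.2)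
    (hmin : IsLocalMin (fun x => u₁ (p.1, x) - u₂ (p.1, x)) p.2) :
    Lop a b u₂ p ≤ Lop a b u₁ p := by
  set w₁ : (Fin N → ℝ) → ℝ := fun x => u₁ (p.1, x) with hw₁
  set w₂ : (Fin N → ℝ) → ℝ := fun x => u₂ (p.1, x) with hw₂
  have hgrad : fderiv ℝ w₁ p.2 = fderiv ℝ w₂ p.2 := by
    have := hmin.fderiv_eq_zero
    rwa [fderiv_fun_sub (h₁.differentiableAt (by norm_num))
      (h₂.differentiableAt (by norm_num)), sub_eq_zero] at this
  have hdiff {w : (Fin N → ℝ) → ℝ} (hw : ContDiffAt ℝ 2 w p.2) :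
      DifferentiableAt ℝ (fderiv ℝ w) p.2 :=
    (hw.fderiv_right (m := 1) (by norm_num)).differentiableAt (by norm_num)
  have hev {w : (Fin N → ℝ) → ℝ} (hw : ContDiffAt ℝ 2 w p.2) :
      ∀ᶠ y in 𝓝 p.2, DifferentiableAt ℝ w y :=
    (hw.eventually (by simp)).mono fun y hy => hy.differentiableAt (by norm_num)
  have hhess : fderiv ℝ (fderiv ℝ fun x => w₁ x - w₂ x) p.2 =
      fderiv ℝ (fderiv ℝ w₁) p.2 - fderiv ℝ (fderiv ℝ w₂) p.2 := by
    have : (fderiv ℝ fun x => w₁ x - w₂ x) =ᶠ[𝓝 p.2] fun x => fderiv ℝ w₁ x - fderiv ℝ w₂ x := by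
      filter_upwards [hev h₁, hev h₂] with y hy₁ hy₂ using fderiv_fun_sub hy₁ hy₂
    rw [this.fderiv_eq, fderiv_fun_sub (hdiff h₁) (hdiff h₂)]
  have hquad (ξ : Fin N → ℝ) : 0 ≤ ∑ i, ∑ j, ξ i * ξ j *
      (Matrix.of fun i j => pspace2 i j u₁ p - pspace2 i j u₂ p) i j := by
    have := hmin.fderiv_fderiv_nonneg (h₁.sub h₂) ξ
    rw [hhess] at this
    set B := fderiv ℝ (fderiv ℝ w₁) p.2 - fderiv ℝ (fderiv ℝ w₂) p.2 with hB
    have hexp : B ξ ξ = ∑ i, ∑ j, ξ i * ξ j * B (Pi.single i 1) (Pi.single j 1) := by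
      have hξ : ξ = ∑ i, ξ i • (Pi.single i (1 : ℝ) : Fin N → ℝ) := by
        simpa using pi_eq_sum_univ' ξ
      conv_lhs => rw [hξ]
      simp only [map_sum, map_smul, sum_apply, smul_apply, smul_eq_mul, Finset.mul_sum]
      rw [Finset.sum_comm]
      refine Finset.sum_congr rfl fun i _ => Finset.sum_congr rfl fun j _ => by ring
    rw [hexp] at this
    simpa [hB, pspace2_eq_fderiv_fderiv _ _ h₁, pspace2_eq_fderiv_fderiv _ _ h₂] using this
  have hmain := ha.sum_mul_nonneg hquad
  have hfirst : ∑ j, b j p * pspace j u₁ p = ∑ j, b j p * pspace j u₂ p := by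
    simp only [pspace]
    rw [← hw₁, ← hw₂, hgrad]
  simp only [Matrix.of_apply, mul_sub, Finset.sum_sub_distrib, sub_nonneg] at hmain
  rw [Lop, Lop, hfirst]
  gcongr

/-- If `e^{-lt} w(t)` attains its minimum over `[0, t]` at the right endpoint, then
`w'(t) ≤ l w(t)`. -/
theorem deriv_le_mul_of_isMinOn_exp_mul {w : ℝ → ℝ} {l t : ℝ} (ht : 0 < t)
    (hw : DifferentiableAt ℝ w t)
    (hmin : IsMinOn (fun s => Real.exp (-l * s) * w s) (Icc 0 t) t) :
    deriv w t ≤ l * w t := by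
  have hexp : HasDerivAt (fun s => Real.exp (-l * s)) (Real.exp (-l * t) * -l) t := by
    simpa using ((hasDerivAt_id t).const_mul (-l)).exp
  have hderiv := hexp.mul hw.hasDerivAt
  have hcone : 0 - t ∈ posTangentConeAt (Icc 0 t) t :=
    sub_mem_posTangentConeAt_of_segment_subset (by rw [segment_symm, segment_eq_Icc ht.le])
  have hnonneg := hmin.localize.hasFDerivWithinAt_nonneg
    hderiv.hasFDerivAt.hasFDerivWithinAt hcone
  simp only [ContinuousLinearMap.toSpanSingleton_apply, smul_eq_mul] at hnonneg
  have hfactor : 0 ≤ (t * Real.exp (-l * t)) * (l * w t - deriv w t) := by linarith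
  have := nonneg_of_mul_nonneg_right hfactor (by positivity)
  linarith

/-- Comparison principle for the linear parabolic operator `∂ₜ - L + c` with `c` bounded below. -/
theorem parabolic_comparison {N : ℕ} {Ω : Set (Fin N → ℝ)} (hΩo : IsOpen Ω)
    (hΩb : Bornology.IsBounded Ω) {T : ℝ} (hT : 0 < T)
    {a : Fin N → Fin N → ℝ × (Fin N → ℝ) → ℝ} {b : Fin N → ℝ × (Fin N → ℝ) → ℝ}
    (ha : ∀ p ∈ Ioo 0 T ×ˢ Ω, (Matrix.of fun i j => a i j p).PosSemidef)
    {c : ℝ × (Fin N → ℝ) → ℝ} {C : ℝ} (hc : ∀ p ∈ Ioo 0 T ×ˢ Ω, -C ≤ c p)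
    {u₁ u₂ : ℝ × (Fin N → ℝ) → ℝ}
    (hcont₁ : ContinuousOn u₁ (Icc 0 T ×ˢ closure Ω))
    (hcont₂ : ContinuousOn u₂ (Icc 0 T ×ˢ closure Ω))
    (h₁ : IsC12 (Ioo 0 T ×ˢ Ω) u₁) (h₂ : IsC12 (Ioo 0 T ×ˢ Ω) u₂)
    (hineq : ∀ p ∈ Ioo 0 T ×ˢ Ω, ptime u₂ p - Lop a b u₂ p + c p * u₂ p ≤
      ptime u₁ p - Lop a b u₁ p + c p * u₁ p)
    (hbdry : ∀ t ∈ Icc 0 T, ∀ x ∈ frontier Ω, u₂ (t, x) ≤ u₁ (t, x))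
    (hinit : ∀ x ∈ closure Ω, u₂ (0, x) ≤ u₁ (0, x)) :
    ∀ p ∈ Icc 0 T ×ˢ closure Ω, u₂ p ≤ u₁ p := by
  have hbefore : ∀ t ∈ Ico 0 T, ∀ x ∈ closure Ω, u₂ (t, x) ≤ u₁ (t, x) := by
    intro T' hT' x hx
    set z : ℝ × (Fin N → ℝ) → ℝ := fun p => Real.exp (-(C + 1) * p.1) * (u₁ p - u₂ p) with hz
    have hsub : Icc 0 T' ×ˢ closure Ω ⊆ Icc 0 T ×ˢ closure Ω :=
      prod_mono (Icc_subset_Icc_right hT'.2.le) le_rfl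
    have hmem : (T', x) ∈ Icc 0 T' ×ˢ closure Ω := ⟨⟨hT'.1, le_rfl⟩, hx⟩
    have hzcont : ContinuousOn z (Icc 0 T' ×ˢ closure Ω) :=
      (Continuous.continuousOn (by fun_prop)).mul ((hcont₁.mono hsub).sub (hcont₂.mono hsub))
    obtain ⟨⟨t₀, x₀⟩, ⟨ht₀, hx₀⟩, hmin⟩ :=
      (isCompact_Icc.prod hΩb.isCompact_closure).exists_isMinOn ⟨_, hmem⟩ hzcont
    simp only at ht₀ hx₀
    by_cases hsign : u₂ (t₀, x₀) ≤ u₁ (t₀, x₀)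
    · have : 0 ≤ z (T', x) :=
        (mul_nonneg (Real.exp_pos _).le (sub_nonneg.2 hsign)).trans (hmin hmem)
      exact sub_nonneg.1 (nonneg_of_mul_nonneg_right this (Real.exp_pos _))
    push Not at hsign
    have ht₀pos : 0 < t₀ := by
      refine ht₀.1.lt_of_ne ?_
      rintro rfl
      exact hsign.not_ge (hinit x₀ hx₀)
    have hx₀Ω : x₀ ∈ Ω := by
      by_contra hnot
      refine hsign.not_ge (hbdry t₀ ⟨ht₀.1, ht₀.2.trans hT'.2.le⟩ x₀ ?_)
      rw [hΩo.frontier_eq]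
      exact ⟨hx₀, hnot⟩
    have hD : (t₀, x₀) ∈ Ioo 0 T ×ˢ Ω := ⟨⟨ht₀pos, ht₀.2.trans_lt hT'.2⟩, hx₀Ω⟩
    have hspace : IsLocalMin (fun x => u₁ (t₀, x) - u₂ (t₀, x)) x₀ := by
      filter_upwards [hΩo.mem_nhds hx₀Ω] with y hy
      have hle : z (t₀, x₀) ≤ z (t₀, y) := hmin ⟨ht₀, subset_closure hy⟩
      exact le_of_mul_le_mul_left hle (Real.exp_pos _)
    have hL := Lop_le_of_isLocalMin (b := b) (ha _ hD) (h₁.2.2.1 _ hD) (h₂.2.2.1 _ hD) hspace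
    have hd₁ := h₁.1 _ hD
    have hd₂ := h₂.1 _ hD
    have htime := deriv_le_mul_of_isMinOn_exp_mul (w := fun t => u₁ (t, x₀) - u₂ (t, x₀))
      (l := C + 1) ht₀pos (hd₁.sub hd₂)
      fun s hs => hmin (show (s, x₀) ∈ Icc 0 T' ×ˢ closure Ω from ⟨⟨hs.1, hs.2.trans ht₀.2⟩, hx₀⟩)
    rw [deriv_fun_sub hd₁ hd₂] at htime
    have hpde := hineq _ hD
    have hcD := hc _ hD
    simp only [ptime] at hpde
    nlinarith
  rintro ⟨t, x⟩ ⟨ht, hx⟩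
  have hclosure : closure (Ico 0 T) = Icc 0 T := closure_Ico hT.ne
  have hslice : MapsTo (fun s : ℝ => (s, x)) (closure (Ico 0 T)) (Icc 0 T ×ˢ closure Ω) :=
    fun s hs => ⟨hclosure ▸ hs, hx⟩
  have hpair : ContinuousOn (fun s : ℝ => (s, x)) (closure (Ico 0 T)) := by fun_prop
  exact le_on_closure (fun s hs => hbefore s hs x hx) (hcont₂.comp hpair hslice)
    (hcont₁.comp hpair hslice) (hclosure ▸ ht)

/-- A shift `k` dominating `-φ' + ∫ max(0, -∂G/∂y)` makes `y ↦ k y + φ(y) + ∫ G(s, y) ds`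
nondecreasing between two comparison points. -/
theorem shifted_add_integral_mono {k t y₁ y₂ : ℝ} {φ : ℝ → ℝ} {G : ℝ → ℝ → ℝ} (ht : 0 ≤ t)
    (hy : y₁ ≤ y₂) (hφ : Differentiable ℝ φ) (hG : ∀ s ∈ Icc 0 t, Differentiable ℝ (G s))
    (hG₁ : ContinuousOn (fun s => G s y₁) (Icc 0 t))
    (hG₂ : ContinuousOn (fun s => G s y₂) (Icc 0 t))
    (hk : ∀ η ∈ Icc y₁ y₂, ∀ w : ℝ → ℝ, (∀ s ∈ Icc 0 t, w s ∈ Icc y₁ y₂) →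
      -deriv φ η + ∫ s in (0:ℝ)..t, max 0 (-deriv (G s) (w s)) ≤ k) :
    k * y₁ + φ y₁ + ∫ s in (0:ℝ)..t, G s y₁ ≤ k * y₂ + φ y₂ + ∫ s in (0:ℝ)..t, G s y₂ := by
  rcases hy.eq_or_lt with rfl | hlt
  · rfl
  have hpos : 0 < y₂ - y₁ := sub_pos.2 hlt
  obtain ⟨η, hη, hηslope⟩ :=
    exists_deriv_eq_slope φ hlt hφ.continuous.continuousOn hφ.differentiableOn
  have hmvt (s : ℝ) : ∃ ξ, s ∈ Icc 0 t →
      ξ ∈ Icc y₁ y₂ ∧ deriv (G s) ξ = (G s y₂ - G s y₁) / (y₂ - y₁) := by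
    by_cases hs : s ∈ Icc 0 t
    · obtain ⟨ξ, hξ, h⟩ :=
        exists_deriv_eq_slope (G s) hlt (hG s hs).continuous.continuousOn (hG s hs).differentiableOn
      exact ⟨ξ, fun _ => ⟨Ioo_subset_Icc_self hξ, h⟩⟩
    · exact ⟨0, fun h => absurd h hs⟩
  choose w hw using hmvt
  have hk' := hk η (Ioo_subset_Icc_self hη) w fun s hs => (hw s hs).1
  rw [intervalIntegral.integral_congr (g := fun s => max 0 (-((G s y₂ - G s y₁) / (y₂ - y₁))))
    fun s hs => by simp only [(hw s (by rwa [uIcc_of_le ht] at hs)).2]] at hk'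
  have hquot : ContinuousOn (fun s => -((G s y₂ - G s y₁) / (y₂ - y₁))) (Icc 0 t) :=
    ((hG₂.sub hG₁).div_const _).neg
  have hle : ∫ s in (0:ℝ)..t, -((G s y₂ - G s y₁) / (y₂ - y₁)) ≤
      ∫ s in (0:ℝ)..t, max 0 (-((G s y₂ - G s y₁) / (y₂ - y₁))) :=
    intervalIntegral.integral_mono_on ht (hquot.intervalIntegrable_of_Icc ht)
      ((continuousOn_const.sup hquot).intervalIntegrable_of_Icc ht) fun s _ => le_max_right _ _
  rw [intervalIntegral.integral_neg, intervalIntegral.integral_div,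
    intervalIntegral.integral_sub (hG₂.intervalIntegrable_of_Icc ht)
      (hG₁.intervalIntegrable_of_Icc ht)] at hle
  rw [hηslope] at hk'
  have hfinal : -(((φ y₂ - φ y₁) + ((∫ s in (0:ℝ)..t, G s y₂) - ∫ s in (0:ℝ)..t, G s y₁)) /
      (y₂ - y₁)) ≤ k := by
    rw [add_div, neg_add]
    linarith
  rw [neg_le, le_div_iff₀ hpos] at hfinal
  linarith

/-- Invariance of the order interval `⟨û, ũ⟩` under one step of the
monotone iteration: if `û ≤ v ≤ ũ` and `u` solves `L_c[u] = F₁(t, x, v)` in `D`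
with boundary and initial values between `û` and `ũ`, then `û ≤ u ≤ ũ`. -/
theorem order_interval_invariance {N : ℕ} (hN : 1 ≤ N)
    (Ω : Set (Fin N → ℝ)) (hΩo : IsOpen Ω) (hΩb : Bornology.IsBounded Ω)
    (T : ℝ) (hT : 0 < T)
    (a : Fin N → Fin N → ℝ × (Fin N → ℝ) → ℝ) (b : Fin N → ℝ × (Fin N → ℝ) → ℝ)
    (ha : ∀ i j, ContinuousOn (a i j) (Icc 0 T ×ˢ closure Ω))
    (hb : ∀ j, ContinuousOn (b j) (Icc 0 T ×ˢ closure Ω))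
    (hsym : ∀ i j, ∀ p ∈ Icc (0:ℝ) T ×ˢ closure Ω, a i j p = a j i p)
    (hpos : ∀ p ∈ Icc (0:ℝ) T ×ˢ closure Ω, ∀ ξ : Fin N → ℝ, ξ ≠ 0 →
      0 < ∑ i, ∑ j, a i j p * ξ i * ξ j)
    -- the nonlinearity f : continuous, C¹ in its last argument
    (f : ℝ × (Fin N → ℝ) → ℝ → ℝ)
    (hfcont : ContinuousOn (fun q : (ℝ × (Fin N → ℝ)) × ℝ => f q.1 q.2)
      ((Icc 0 T ×ˢ closure Ω) ×ˢ (univ : Set ℝ)))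
    (hfC1 : ∀ p ∈ Icc (0:ℝ) T ×ˢ closure Ω, ContDiff ℝ 1 (f p))
    -- the kernel g₀ : continuous, C¹ in (η₁, η₂), nondecreasing in η₂
    (g₀ : ℝ × (Fin N → ℝ) → ℝ → ℝ → ℝ → ℝ)
    (hg₀cont : ContinuousOn
      (fun q : (ℝ × (Fin N → ℝ)) × ℝ × ℝ × ℝ => g₀ q.1 q.2.1 q.2.2.1 q.2.2.2)
      ((Icc 0 T ×ˢ closure Ω) ×ˢ Icc 0 T ×ˢ (univ : Set ℝ) ×ˢ (univ : Set ℝ)))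
    (hg₀C1 : ∀ p ∈ Icc (0:ℝ) T ×ˢ closure Ω, ∀ s ∈ Icc (0:ℝ) T,
      ContDiff ℝ 1 (fun q : ℝ × ℝ => g₀ p s q.1 q.2))
    (hg₀mono : ∀ p ∈ Icc (0:ℝ) T ×ˢ closure Ω, ∀ s ∈ Icc (0:ℝ) T, ∀ η₁ : ℝ,
      Monotone (g₀ p s η₁))
    -- ordered subsolution û and supersolution ũ
    (uhat utilde : ℝ × (Fin N → ℝ) → ℝ)
    (hhatcont : ContinuousOn uhat (Icc 0 T ×ˢ closure Ω))
    (htildecont : ContinuousOn utilde (Icc 0 T ×ˢ closure Ω))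
    (hhat12 : IsC12 (Ioo 0 T ×ˢ Ω) uhat)
    (htilde12 : IsC12 (Ioo 0 T ×ˢ Ω) utilde)
    (horder : ∀ p ∈ Icc (0:ℝ) T ×ˢ closure Ω, uhat p ≤ utilde p)
    (hsub : ∀ p ∈ Ioo (0:ℝ) T ×ˢ Ω,
      ptime uhat p - Lop a b uhat p ≤ f p (uhat p) + volterra g₀ uhat p)
    (hsup : ∀ p ∈ Ioo (0:ℝ) T ×ˢ Ω,
      f p (utilde p) + volterra g₀ utilde p ≤ ptime utilde p - Lop a b utilde p)
    -- the shift coefficient c : continuous, bounded, dominating -f_u + ∫ max(0, -∂g₀/∂η₁)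
    (c : ℝ × (Fin N → ℝ) → ℝ)
    (hccont : ContinuousOn c (Icc 0 T ×ˢ closure Ω))
    (hcbdd : ∃ C, ∀ p ∈ Icc (0:ℝ) T ×ˢ closure Ω, |c p| ≤ C)
    (hcge : ∀ p ∈ Icc (0:ℝ) T ×ˢ closure Ω, ∀ η ∈ Icc (uhat p) (utilde p),
      ∀ w₁ w₂ : ℝ → ℝ,
      (∀ s ∈ Icc (0:ℝ) p.1, w₁ s ∈ Icc (uhat p) (utilde p)) →
      (∀ s ∈ Icc (0:ℝ) p.1, w₂ s ∈ Icc (uhat (s, p.2)) (utilde (s, p.2))) →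
      -(deriv (f p) η)
          + (∫ s in (0:ℝ)..p.1, max 0 (-(deriv (fun y => g₀ p s y (w₂ s)) (w₁ s))))
        ≤ c p)
    -- one iteration step: data v in the order interval, u solving L_c[u] = F₁(·, v)
    (v u : ℝ × (Fin N → ℝ) → ℝ)
    (hvcont : ContinuousOn v (Icc 0 T ×ˢ closure Ω))
    (hvorder : ∀ p ∈ Icc (0:ℝ) T ×ˢ closure Ω, uhat p ≤ v p ∧ v p ≤ utilde p)
    (hucont : ContinuousOn u (Icc 0 T ×ˢ closure Ω))
    (hu12 : IsC12 (Ioo 0 T ×ˢ Ω) u)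
    (hueq : ∀ p ∈ Ioo (0:ℝ) T ×ˢ Ω,
      ptime u p - Lop a b u p + c p * u p = F1 c f g₀ v p)
    (hubdry : ∀ t ∈ Icc (0:ℝ) T, ∀ x ∈ frontier Ω,
      uhat (t, x) ≤ u (t, x) ∧ u (t, x) ≤ utilde (t, x))
    (huinit : ∀ x ∈ closure Ω, uhat (0, x) ≤ u (0, x) ∧ u (0, x) ≤ utilde (0, x)) :
    ∀ p ∈ Icc (0:ℝ) T ×ˢ closure Ω, uhat p ≤ u p ∧ u p ≤ utilde p := by
  obtain ⟨C, hC⟩ := hcbdd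
  have hDsub : Ioo (0:ℝ) T ×ˢ Ω ⊆ Icc 0 T ×ˢ closure Ω :=
    prod_mono Ioo_subset_Icc_self subset_closure
  have hA : ∀ p ∈ Ioo (0:ℝ) T ×ˢ Ω, (Matrix.of fun i j => a i j p).PosSemidef := by
    intro p hp
    refine Matrix.PosSemidef.of_dotProduct_mulVec_nonneg ?_ fun ξ => ?_
    · ext i j
      simpa using hsym j i p (hDsub hp)
    · rcases eq_or_ne ξ 0 with rfl | hξ
      · simp
      · refine (hpos p (hDsub hp) ξ hξ).le.trans_eq ?_
        simp only [dotProduct, Matrix.mulVec, Matrix.of_apply, star_trivial, Finset.mul_sum]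
        exact Finset.sum_congr rfl fun i _ => Finset.sum_congr rfl fun j _ => by ring
  have hclow : ∀ p ∈ Ioo (0:ℝ) T ×ˢ Ω, -C ≤ c p := fun p hp => (abs_le.1 (hC p (hDsub hp))).1
  -- continuity in `s` of the kernel along a continuous function
  have hker {p : ℝ × (Fin N → ℝ)} (hp : p ∈ Icc (0:ℝ) T ×ˢ closure Ω) (y : ℝ)
      {w : ℝ × (Fin N → ℝ) → ℝ} (hw : ContinuousOn w (Icc 0 T ×ˢ closure Ω)) :
      ContinuousOn (fun s => g₀ p s y (w (s, p.2))) (Icc 0 p.1) := by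
    have hs {s : ℝ} (h : s ∈ Icc 0 p.1) : s ∈ Icc 0 T := ⟨h.1, h.2.trans hp.1.2⟩
    have hwc : ContinuousOn (fun s : ℝ => w (s, p.2)) (Icc 0 p.1) :=
      hw.comp (f := fun s : ℝ => (s, p.2)) (by fun_prop) fun s h => ⟨hs h, hp.2⟩
    exact hg₀cont.comp (f := fun s : ℝ => (p, s, y, w (s, p.2)))
      (continuousOn_const.prodMk (continuousOn_id.prodMk (continuousOn_const.prodMk hwc)))
      fun s h => ⟨hp, hs h, mem_univ _, mem_univ _⟩
  have hF1mono (w : ℝ × (Fin N → ℝ) → ℝ) (hw : ContinuousOn w (Icc 0 T ×ˢ closure Ω))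
      (hw_mem : ∀ p ∈ Icc (0:ℝ) T ×ˢ closure Ω, w p ∈ Icc (uhat p) (utilde p))
      {p : ℝ × (Fin N → ℝ)} (hp : p ∈ Icc (0:ℝ) T ×ˢ closure Ω) {y₁ y₂ : ℝ}
      (h₁ : uhat p ≤ y₁) (h₁₂ : y₁ ≤ y₂) (h₂ : y₂ ≤ utilde p) :
      c p * y₁ + f p y₁ + ∫ s in (0:ℝ)..p.1, g₀ p s y₁ (w (s, p.2)) ≤
        c p * y₂ + f p y₂ + ∫ s in (0:ℝ)..p.1, g₀ p s y₂ (w (s, p.2)) := by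
    have hs {s : ℝ} (h : s ∈ Icc 0 p.1) : s ∈ Icc 0 T := ⟨h.1, h.2.trans hp.1.2⟩
    refine shifted_add_integral_mono (G := fun s y => g₀ p s y (w (s, p.2))) hp.1.1 h₁₂
      ((hfC1 p hp).differentiable (by norm_num)) (fun s h => ?_) (hker hp y₁ hw) (hker hp y₂ hw)
      fun η hη w₁ hw₁ => hcge p hp η (Icc_subset_Icc h₁ h₂ hη) w₁ (fun s => w (s, p.2))
        (fun s h => Icc_subset_Icc h₁ h₂ (hw₁ s h)) fun s h => hw_mem _ ⟨hs h, hp.2⟩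
    exact ((hg₀C1 p hp s (hs h)).differentiable (by norm_num)).comp
      (differentiable_id.prodMk (differentiable_const _))
  have hvolt {p : ℝ × (Fin N → ℝ)} (hp : p ∈ Icc (0:ℝ) T ×ˢ closure Ω)
      {w₁ w₂ : ℝ × (Fin N → ℝ) → ℝ} (hw₁ : ContinuousOn w₁ (Icc 0 T ×ˢ closure Ω))
      (hw₂ : ContinuousOn w₂ (Icc 0 T ×ˢ closure Ω))
      (hle : ∀ q ∈ Icc (0:ℝ) T ×ˢ closure Ω, w₁ q ≤ w₂ q) (y : ℝ) :
      ∫ s in (0:ℝ)..p.1, g₀ p s y (w₁ (s, p.2)) ≤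
        ∫ s in (0:ℝ)..p.1, g₀ p s y (w₂ (s, p.2)) := by
    have hs {s : ℝ} (h : s ∈ Icc 0 p.1) : s ∈ Icc 0 T := ⟨h.1, h.2.trans hp.1.2⟩
    exact intervalIntegral.integral_mono_on hp.1.1
      ((hker hp y hw₁).intervalIntegrable_of_Icc hp.1.1)
      ((hker hp y hw₂).intervalIntegrable_of_Icc hp.1.1)
      fun s h => hg₀mono p hp s (hs h) y (hle _ ⟨hs h, hp.2⟩)
  have hlower := parabolic_comparison (a := a) (b := b) hΩo hΩb hT hA hclow hucont hhatcont hu12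
    hhat12
    (fun p hp => by
      have hp' := hDsub hp
      have := hF1mono uhat hhatcont (fun q hq => ⟨le_rfl, horder q hq⟩) hp' le_rfl
        (hvorder p hp').1 (hvorder p hp').2
      have := hvolt hp' hhatcont hvcont (fun q hq => (hvorder q hq).1) (v p)
      have := hsub p hp
      have := hueq p hp
      simp only [F1, volterra] at *
      linarith)
    (fun t ht x hx => (hubdry t ht x hx).1) (fun x hx => (huinit x hx).1)
  have hupper := parabolic_comparison (a := a) (b := b) hΩo hΩb hT hA hclow htildecont hucont
    htilde12 hu12
    (fun p hp => by
      have hp' := hDsub hp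
      have := hF1mono utilde htildecont (fun q hq => ⟨horder q hq, le_rfl⟩) hp'
        (hvorder p hp').1 (hvorder p hp').2 le_rfl
      have := hvolt hp' hvcont htildecont (fun q hq => (hvorder q hq).2) (v p)
      have := hsup p hp
      have := hueq p hp
      simp only [F1, volterra] at *
      linarith)
    (fun t ht x hx => (hubdry t ht x hx).2) (fun x hx => (huinit x hx).2)
  exact fun p hp => ⟨hlower p hp, hupper p hp⟩
end

section
/- (Uniqueness for the nonlinear Volterra integro-parabolic problem.) Assume: f : [0,T] × Ω̄ × ℝ → ℝ is continuous and, for each r > 0, there is K(r) > 0 with |f(t,x,η) − f(t,x,η′)| ≤ K(r)|η − η′| whenever |η|, |η′| ≤ r; g₀ : [0,T] × Ω̄ × [0,T] × ℝ × ℝ → ℝ is continuous and, for each r > 0, there is K₀(r) > 0 with |g₀(t,x,s,η₁,η₂) − g₀(t,x,s,η₁′,η₂′)| ≤ K₀(r)(|η₁ − η₁′| + |η₂ − η₂′|) whenever |η₁|, |η₂|, |η₁′|, |η₂′| ≤ r. Let u, v ∈ C([0,T] × Ω̄) be of class C^{1,2} on D, both satisfying w_t − Lw = f(t,x,w) + ∫₀ᵗ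 g₀(t,x,s,w(t,x),w(s,x)) ds in D, with u(t,x) = v(t,x) for t ∈ [0,T], x ∈ ∂Ω, and u(0,·) = v(0,·) on Ω̄. Then u = v on [0,T] × Ω̄. -/
open Set

open Filter Topology

theorem IsLocalMax.deriv_deriv_nonpos {ψ : ℝ → ℝ} {s : ℝ} (hmax : IsLocalMax ψ s)
    (hc : ContinuousAt ψ s) : deriv (deriv ψ) s ≤ 0 := by
  by_contra! hpos
  have hmin := isLocalMin_of_deriv_deriv_pos hpos hmax.deriv_eq_zero hc
  have heq : ψ =ᶠ[𝓝 s] fun _ => ψ s := by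
    filter_upwards [hmax, hmin] with y h₁ h₂ using le_antisymm h₁ h₂
  rw [heq.deriv.deriv_eq] at hpos
  simp at hpos

theorem IsLocalMax.fderiv_fderiv_apply_nonpos {E : Type*} [NormedAddCommGroup E]
    [NormedSpace ℝ E] {φ : E → ℝ} {x : E} (hmax : IsLocalMax φ x) (hφ : ContDiffAt ℝ 2 φ x)
    (ξ : E) : fderiv ℝ (fun y => fderiv ℝ φ y ξ) x ξ ≤ 0 := by
  set γ : ℝ → E := fun s => x + s • ξ with hγ
  have hγ0 : γ 0 = x := by simp [hγ]
  have hγd : ∀ s, HasDerivAt γ ξ s := fun s => by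
    simpa [hγ] using ((hasDerivAt_id s).smul_const ξ).const_add x
  have hγt : Tendsto γ (𝓝 0) (𝓝 x) := by
    simpa only [hγ0] using (hγd 0).continuousAt.tendsto
  have hdiff : ∀ᶠ y in 𝓝 x, DifferentiableAt ℝ φ y :=
    (hφ.eventually (by simp)).mono fun y hy => hy.differentiableAt (by simp)
  have hderiv : deriv (φ ∘ γ) =ᶠ[𝓝 0] fun s => fderiv ℝ φ (γ s) ξ := by
    filter_upwards [hγt.eventually hdiff] with s hs
    exact (hs.hasFDerivAt.comp_hasDerivAt s (hγd s)).deriv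
  have hd2 : DifferentiableAt ℝ (fun y => fderiv ℝ φ y ξ) x :=
    ((hφ.fderiv_right (m := 1) (by norm_num)).differentiableAt (by simp)).clm_apply
      (differentiableAt_const ξ)
  have hsecond : deriv (deriv (φ ∘ γ)) 0 = fderiv ℝ (fun y => fderiv ℝ φ y ξ) x ξ := by
    rw [hderiv.deriv_eq]
    rw [← hγ0] at hd2
    have := (hd2.hasFDerivAt.comp_hasDerivAt (0 : ℝ) (hγd 0)).deriv
    rwa [hγ0] at this
  rw [← hsecond]
  apply IsLocalMax.deriv_deriv_nonpos
  · have : ∀ᶠ s in 𝓝 (0:ℝ), φ (γ s) ≤ φ x := hγt.eventually hmax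
    simpa [IsLocalMax, IsMaxFilter, hγ0] using this
  · refine ContinuousAt.comp ?_ (hγd 0).continuousAt
    rw [hγ0]
    exact hφ.continuousAt

theorem Matrix.PosSemidef.sum_mul_nonpos {ι : Type*} [Fintype ι] {A H : Matrix ι ι ℝ}
    (hA : A.PosSemidef) (hH : ∀ ξ : ι → ℝ, ∑ i, ∑ j, ξ i * ξ j * H i j ≤ 0) :
    ∑ i, ∑ j, A i j * H i j ≤ 0 := by
  classical
  open scoped MatrixOrder in
  obtain ⟨B, rfl⟩ := CStarAlgebra.nonneg_iff_eq_star_mul_self.mp hA.nonneg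
  have key : ∑ i, ∑ j, (star B * B) i j * H i j = ∑ k, ∑ i, ∑ j, B k i * B k j * H i j := by
    simp only [Matrix.mul_apply, Finset.sum_mul, Matrix.star_apply, star_trivial]
    rw [Finset.sum_comm]
    conv_rhs => rw [Finset.sum_comm]
    rw [Finset.sum_comm]
    exact Finset.sum_congr rfl fun i _ => Finset.sum_comm
  rw [key]
  exact Finset.sum_nonpos fun k _ => hH (B k)

theorem fderiv_fderiv_apply_eq_sum {N : ℕ} {φ : (Fin N → ℝ) → ℝ} {x : Fin N → ℝ}
    (hφ : ContDiffAt ℝ 2 φ x) (ξ : Fin N → ℝ) :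
    fderiv ℝ (fun y => fderiv ℝ φ y ξ) x ξ = ∑ i, ∑ j, ξ i * ξ j *
      fderiv ℝ (fun y => fderiv ℝ φ y (Pi.single j 1)) x (Pi.single i 1) := by
  have hd : DifferentiableAt ℝ (fderiv ℝ φ) x :=
    (hφ.fderiv_right (m := 1) (by norm_num)).differentiableAt (by simp)
  have happ : ∀ η ζ : Fin N → ℝ,
      fderiv ℝ (fun y => fderiv ℝ φ y η) x ζ = fderiv ℝ (fderiv ℝ φ) x ζ η := fun η ζ => by
    rw [fderiv_clm_apply hd (differentiableAt_const η)]
    simp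
  simp only [happ]
  have hξ : ξ = ∑ i, ξ i • (Pi.single i 1 : Fin N → ℝ) := by
    simpa using (pi_eq_sum_univ' ξ)
  conv_lhs => rw [hξ]
  simp only [map_sum, map_smul, _root_.sum_apply, _root_.smul_apply,
    smul_eq_mul, Finset.mul_sum, mul_assoc]
  rw [Finset.sum_comm]
  refine Finset.sum_congr rfl fun i _ => Finset.sum_congr rfl fun j _ => by ring

theorem HasDerivAt.nonneg_of_le_left {h : ℝ → ℝ} {h' t : ℝ} (hd : HasDerivAt h h' t)
    (hle : ∀ᶠ s in 𝓝[<] t, h s ≤ h t) : 0 ≤ h' := by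
  have ht : Tendsto (slope h t) (𝓝[<] t) (𝓝 h') :=
    hd.tendsto_slope.mono_left (nhdsWithin_mono _ fun s hs => ne_of_lt hs)
  refine ge_of_tendsto ht ?_
  filter_upwards [hle, self_mem_nhdsWithin] with s hs hst
  rw [slope_def_field]
  exact div_nonneg_of_nonpos (by linarith) (by linarith [mem_Iio.mp hst])

theorem Lop_le_of_isLocalMax_sub {N : ℕ} {a : Fin N → Fin N → ℝ × (Fin N → ℝ) → ℝ}
    {b : Fin N → ℝ × (Fin N → ℝ) → ℝ} {u v : ℝ × (Fin N → ℝ) → ℝ} {p : ℝ × (Fin N → ℝ)}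
    (hsym : ∀ i j, a i j p = a j i p)
    (hpos : ∀ ξ : Fin N → ℝ, ξ ≠ 0 → 0 < ∑ i, ∑ j, a i j p * ξ i * ξ j)
    (hu : ContDiffAt ℝ 2 (fun x => u (p.1, x)) p.2)
    (hv : ContDiffAt ℝ 2 (fun x => v (p.1, x)) p.2)
    (hmax : IsLocalMax (fun x => u (p.1, x) - v (p.1, x)) p.2) :
    Lop a b u p ≤ Lop a b v p := by
  have hdu := (hu.eventually (by simp)).mono fun y hy => hy.differentiableAt (by simp)
  have hdv := (hv.eventually (by simp)).mono fun y hy => hy.differentiableAt (by simp)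
  have hgrad : ∀ j, pspace j u p = pspace j v p := fun j => by
    have h := hmax.fderiv_eq_zero
    rw [fderiv_fun_sub hdu.self_of_nhds hdv.self_of_nhds] at h
    simp only [pspace, sub_eq_zero.mp h]
  have hhess : ∀ i j, pspace2 i j u p - pspace2 i j v p =
      fderiv ℝ (fun y => fderiv ℝ (fun x => u (p.1, x) - v (p.1, x)) y (Pi.single j 1)) p.2
        (Pi.single i 1) := fun i j => by
    have heq : (fun y => fderiv ℝ (fun x => u (p.1, x) - v (p.1, x)) y (Pi.single j 1))
        =ᶠ[𝓝 p.2] fun y => fderiv ℝ (fun x => u (p.1, x)) y (Pi.single j 1) -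
          fderiv ℝ (fun x => v (p.1, x)) y (Pi.single j 1) := by
      filter_upwards [hdu, hdv] with y h₁ h₂
      rw [fderiv_fun_sub h₁ h₂]
      rfl
    have hd : ∀ {φ : (Fin N → ℝ) → ℝ}, ContDiffAt ℝ 2 φ p.2 →
        DifferentiableAt ℝ (fun y => fderiv ℝ φ y (Pi.single j 1)) p.2 := fun hφ =>
      ((hφ.fderiv_right (m := 1) (by norm_num)).differentiableAt (by simp)).clm_apply
        (differentiableAt_const _)
    rw [heq.fderiv_eq, fderiv_fun_sub (hd hu) (hd hv)]
    rfl
  have hA : (Matrix.of fun i j => a i j p).PosSemidef := by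
    refine .of_dotProduct_mulVec_nonneg (by ext i j; simpa using hsym j i) fun ξ => ?_
    have heq : star ξ ⬝ᵥ (Matrix.of fun i j => a i j p).mulVec ξ =
        ∑ i, ∑ j, a i j p * ξ i * ξ j := by
      simp only [dotProduct, Matrix.mulVec, Finset.mul_sum, Matrix.of_apply, star_trivial]
      exact Finset.sum_congr rfl fun i _ => Finset.sum_congr rfl fun j _ => by ring
    rw [heq]
    rcases eq_or_ne ξ 0 with rfl | hξ
    · simp
    · exact (hpos ξ hξ).le
  have hsum := hA.sum_mul_nonpos (H := Matrix.of fun i j => pspace2 i j u p - pspace2 i j v p)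
    fun ξ => by
      simp only [Matrix.of_apply, hhess]
      rw [← fderiv_fderiv_apply_eq_sum (hu.sub hv)]
      exact hmax.fderiv_fderiv_apply_nonpos (hu.sub hv) ξ
  simp only [Matrix.of_apply, mul_sub, Finset.sum_sub_distrib] at hsum
  simp only [Lop, hgrad]
  linarith

theorem intervalIntegrable_volterra {N : ℕ} {C : Set (Fin N → ℝ)} {T : ℝ}
    {g₀ : ℝ × (Fin N → ℝ) → ℝ → ℝ → ℝ → ℝ}
    (hg₀ : ContinuousOn
      (fun q : (ℝ × (Fin N → ℝ)) × ℝ × ℝ × ℝ => g₀ q.1 q.2.1 q.2.2.1 q.2.2.2)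
      ((Icc 0 T ×ˢ C) ×ˢ Icc 0 T ×ˢ (univ : Set ℝ) ×ˢ (univ : Set ℝ)))
    {w : ℝ × (Fin N → ℝ) → ℝ} (hw : ContinuousOn w (Icc 0 T ×ˢ C))
    {p : ℝ × (Fin N → ℝ)} (hp : p ∈ Icc 0 T ×ˢ C) :
    IntervalIntegrable (fun s => g₀ p s (w p) (w (s, p.2))) MeasureTheory.volume 0 p.1 := by
  refine ContinuousOn.intervalIntegrable ?_
  rw [uIcc_of_le hp.1.1]
  have hmem : ∀ s ∈ Icc 0 p.1, s ∈ Icc 0 T := fun s hs => ⟨hs.1, hs.2.trans hp.1.2⟩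
  have hws : ContinuousOn (fun s => w (s, p.2)) (Icc 0 p.1) :=
    hw.comp (by fun_prop) fun s hs => ⟨hmem s hs, hp.2⟩
  exact hg₀.comp (f := fun s => (p, s, w p, w (s, p.2)))
    (continuousOn_const.prodMk (continuousOn_id.prodMk (continuousOn_const.prodMk hws)))
    fun s hs => ⟨hp, hmem s hs, trivial, trivial⟩

/-- At an interior point where the exponentially weighted modulus of `u - v` attains its maximum
over earlier times, `u - v` cannot be positive. -/
theorem sub_nonpos_of_weighted_max {N : ℕ} {Ω : Set (Fin N → ℝ)} (hΩo : IsOpen Ω) {T : ℝ}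
    {a : Fin N → Fin N → ℝ × (Fin N → ℝ) → ℝ} {b : Fin N → ℝ × (Fin N → ℝ) → ℝ}
    (hsym : ∀ i j, ∀ p ∈ Icc (0:ℝ) T ×ˢ closure Ω, a i j p = a j i p)
    (hpos : ∀ p ∈ Icc (0:ℝ) T ×ˢ closure Ω, ∀ ξ : Fin N → ℝ, ξ ≠ 0 →
      0 < ∑ i, ∑ j, a i j p * ξ i * ξ j)
    {f : ℝ × (Fin N → ℝ) → ℝ → ℝ} {r K K₀ : ℝ} (hK₀ : 0 < K₀)
    (hflip : ∀ p ∈ Icc (0:ℝ) T ×ˢ closure Ω,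
      ∀ η η' : ℝ, |η| ≤ r → |η'| ≤ r → |f p η - f p η'| ≤ K * |η - η'|)
    {g₀ : ℝ × (Fin N → ℝ) → ℝ → ℝ → ℝ → ℝ}
    (hg₀cont : ContinuousOn
      (fun q : (ℝ × (Fin N → ℝ)) × ℝ × ℝ × ℝ => g₀ q.1 q.2.1 q.2.2.1 q.2.2.2)
      ((Icc 0 T ×ˢ closure Ω) ×ˢ Icc 0 T ×ˢ (univ : Set ℝ) ×ˢ (univ : Set ℝ)))
    (hg₀lip : ∀ p ∈ Icc (0:ℝ) T ×ˢ closure Ω,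
      ∀ s ∈ Icc (0:ℝ) T, ∀ η₁ η₂ η₁' η₂' : ℝ,
      |η₁| ≤ r → |η₂| ≤ r → |η₁'| ≤ r → |η₂'| ≤ r →
      |g₀ p s η₁ η₂ - g₀ p s η₁' η₂'| ≤ K₀ * (|η₁ - η₁'| + |η₂ - η₂'|))
    {u v : ℝ × (Fin N → ℝ) → ℝ}
    (hucont : ContinuousOn u (Icc 0 T ×ˢ closure Ω))
    (hvcont : ContinuousOn v (Icc 0 T ×ˢ closure Ω))
    (hur : ∀ p ∈ Icc (0:ℝ) T ×ˢ closure Ω, |u p| ≤ r)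
    (hvr : ∀ p ∈ Icc (0:ℝ) T ×ˢ closure Ω, |v p| ≤ r)
    (hu12 : IsC12 (Ioo 0 T ×ˢ Ω) u) (hv12 : IsC12 (Ioo 0 T ×ˢ Ω) v)
    (hueq : ∀ p ∈ Ioo (0:ℝ) T ×ˢ Ω,
      ptime u p - Lop a b u p = f p (u p) + volterra g₀ u p)
    (hveq : ∀ p ∈ Ioo (0:ℝ) T ×ˢ Ω,
      ptime v p - Lop a b v p = f p (v p) + volterra g₀ v p)
    {l : ℝ} (hl : K + 2 * K₀ * T < l) (hl0 : 0 ≤ l)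
    {p : ℝ × (Fin N → ℝ)} (hp : p ∈ Ioo 0 T ×ˢ Ω)
    (hmax : ∀ q ∈ Icc 0 p.1 ×ˢ closure Ω,
      Real.exp (-l * q.1) * |u q - v q| ≤ Real.exp (-l * p.1) * |u p - v p|) :
    u p ≤ v p := by
  obtain ⟨t, x⟩ := p
  obtain ⟨ht, hx⟩ := hp
  simp only at ht hx hmax
  by_contra! hlt
  have hz : 0 < u (t, x) - v (t, x) := sub_pos.mpr hlt
  rw [abs_of_pos hz] at hmax
  set z := u (t, x) - v (t, x) with hzdef
  have htI : t ∈ Icc 0 T := ⟨ht.1.le, ht.2.le⟩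
  have hxC : x ∈ closure Ω := subset_closure hx
  have hpD : (t, x) ∈ Ioo 0 T ×ˢ Ω := ⟨ht, hx⟩
  have hpC : (t, x) ∈ Icc 0 T ×ˢ closure Ω := ⟨htI, hxC⟩
  have hspace : IsLocalMax (fun y => u (t, y) - v (t, y)) x := by
    filter_upwards [hΩo.mem_nhds hx] with y hy
    have h := hmax (t, y) ⟨⟨ht.1.le, le_rfl⟩, subset_closure hy⟩
    exact (le_abs_self _).trans (le_of_mul_le_mul_left h (Real.exp_pos _))
  have hL : Lop a b u (t, x) ≤ Lop a b v (t, x) :=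
    Lop_le_of_isLocalMax_sub (fun i j => hsym i j _ hpC) (hpos _ hpC) (hu12.2.2.1 _ hpD)
      (hv12.2.2.1 _ hpD) hspace
  have htime : l * z ≤ ptime u (t, x) - ptime v (t, x) := by
    have hd := ((hu12.1 _ hpD).hasDerivAt.sub (hv12.1 _ hpD).hasDerivAt)
    have he : HasDerivAt (fun s : ℝ => Real.exp (-l * s)) (Real.exp (-l * t) * (-l)) t := by
      simpa using ((hasDerivAt_id t).const_mul (-l)).exp
    have h := (he.mul hd).nonneg_of_le_left (by
      filter_upwards [Ioo_mem_nhdsLT ht.1] with s hs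
      exact (mul_le_mul_of_nonneg_left (le_abs_self _) (Real.exp_pos _).le).trans
        (hmax (s, x) ⟨⟨hs.1.le, hs.2.le⟩, hxC⟩))
    have h' : 0 ≤ Real.exp (-l * t) * (ptime u (t, x) - ptime v (t, x) - l * z) := by
      refine h.trans_eq ?_
      simp only [ptime, hzdef, Pi.sub_apply]
      ring
    linarith [nonneg_of_mul_nonneg_right h' (Real.exp_pos _)]
  have hf : f (t, x) (u (t, x)) - f (t, x) (v (t, x)) ≤ K * z := by
    have h := hflip _ hpC _ _ (hur _ hpC) (hvr _ hpC)
    rw [abs_of_pos hz] at h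
    exact (le_abs_self _).trans h
  have hg : volterra g₀ u (t, x) - volterra g₀ v (t, x) ≤ 2 * K₀ * T * z := by
    rw [volterra, volterra, ← intervalIntegral.integral_sub
      (intervalIntegrable_volterra hg₀cont hucont hpC)
      (intervalIntegrable_volterra hg₀cont hvcont hpC)]
    have h := intervalIntegral.norm_integral_le_of_norm_le_const (a := 0) (b := t)
      (C := K₀ * (z + z))
      (f := fun s => g₀ (t, x) s (u (t, x)) (u (s, x)) - g₀ (t, x) s (v (t, x)) (v (s, x)))
      fun s hs => by
        rw [uIoc_of_le ht.1.le] at hs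
        have hsC : (s, x) ∈ Icc 0 T ×ˢ closure Ω := ⟨⟨hs.1.le, hs.2.trans ht.2.le⟩, hxC⟩
        refine (hg₀lip _ hpC s hsC.1 _ _ _ _ (hur _ hpC) (hur _ hsC) (hvr _ hpC)
          (hvr _ hsC)).trans ?_
        rw [abs_of_pos hz]
        have hm := hmax (s, x) ⟨⟨hs.1.le, hs.2⟩, hxC⟩
        have hexp : Real.exp (-l * t) ≤ Real.exp (-l * s) :=
          Real.exp_le_exp.mpr (by nlinarith [hs.2])
        have : |u (s, x) - v (s, x)| ≤ z :=
          le_of_mul_le_mul_left (hm.trans (mul_le_mul_of_nonneg_right hexp hz.le))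
            (Real.exp_pos _)
        gcongr
    rw [sub_zero, abs_of_pos ht.1] at h
    refine (le_abs_self _).trans (h.trans ?_)
    have := mul_le_mul_of_nonneg_left ht.2.le (by positivity : 0 ≤ K₀ * (z + z))
    linarith
  have h₁ := hueq _ hpD
  have h₂ := hveq _ hpD
  have h₃ := mul_lt_mul_of_pos_right hl hz
  linarith

/-- Uniqueness for the nonlinear Volterra integro-parabolic Dirichlet
problem: under local Lipschitz conditions on `f` and `g₀` (condition (3) of the paper),
two `C([0,T] × Ω̄) ∩ C^{1,2}(D)` solutions of
`w_t - Lw = f(t,x,w) + ∫₀ᵗ g₀(t,x,s,w(t,x),w(s,x)) ds`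
with the same Dirichlet boundary and initial values coincide. -/
theorem volterra_integro_parabolic_uniqueness {N : ℕ} (hN : 1 ≤ N)
    (Ω : Set (Fin N → ℝ)) (hΩo : IsOpen Ω) (hΩb : Bornology.IsBounded Ω)
    (T : ℝ) (hT : 0 < T)
    (a : Fin N → Fin N → ℝ × (Fin N → ℝ) → ℝ) (b : Fin N → ℝ × (Fin N → ℝ) → ℝ)
    (ha : ∀ i j, ContinuousOn (a i j) (Icc 0 T ×ˢ closure Ω))
    (hb : ∀ j, ContinuousOn (b j) (Icc 0 T ×ˢ closure Ω))
    (hsym : ∀ i j, ∀ p ∈ Icc (0:ℝ) T ×ˢ closure Ω, a i j p = a j i p)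
    (hpos : ∀ p ∈ Icc (0:ℝ) T ×ˢ closure Ω, ∀ ξ : Fin N → ℝ, ξ ≠ 0 →
      0 < ∑ i, ∑ j, a i j p * ξ i * ξ j)
    (f : ℝ × (Fin N → ℝ) → ℝ → ℝ)
    (hfcont : ContinuousOn (fun q : (ℝ × (Fin N → ℝ)) × ℝ => f q.1 q.2)
      ((Icc 0 T ×ˢ closure Ω) ×ˢ (univ : Set ℝ)))
    (hflip : ∀ r > (0:ℝ), ∃ K > (0:ℝ), ∀ p ∈ Icc (0:ℝ) T ×ˢ closure Ω,
      ∀ η η' : ℝ, |η| ≤ r → |η'| ≤ r → |f p η - f p η'| ≤ K * |η - η'|)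
    (g₀ : ℝ × (Fin N → ℝ) → ℝ → ℝ → ℝ → ℝ)
    (hg₀cont : ContinuousOn
      (fun q : (ℝ × (Fin N → ℝ)) × ℝ × ℝ × ℝ => g₀ q.1 q.2.1 q.2.2.1 q.2.2.2)
      ((Icc 0 T ×ˢ closure Ω) ×ˢ Icc 0 T ×ˢ (univ : Set ℝ) ×ˢ (univ : Set ℝ)))
    (hg₀lip : ∀ r > (0:ℝ), ∃ K₀ > (0:ℝ), ∀ p ∈ Icc (0:ℝ) T ×ˢ closure Ω,
      ∀ s ∈ Icc (0:ℝ) T, ∀ η₁ η₂ η₁' η₂' : ℝ,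
      |η₁| ≤ r → |η₂| ≤ r → |η₁'| ≤ r → |η₂'| ≤ r →
      |g₀ p s η₁ η₂ - g₀ p s η₁' η₂'| ≤ K₀ * (|η₁ - η₁'| + |η₂ - η₂'|))
    (u v : ℝ × (Fin N → ℝ) → ℝ)
    (hucont : ContinuousOn u (Icc 0 T ×ˢ closure Ω))
    (hvcont : ContinuousOn v (Icc 0 T ×ˢ closure Ω))
    (hu12 : IsC12 (Ioo 0 T ×ˢ Ω) u)
    (hv12 : IsC12 (Ioo 0 T ×ˢ Ω) v)
    (hueq : ∀ p ∈ Ioo (0:ℝ) T ×ˢ Ω,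
      ptime u p - Lop a b u p = f p (u p) + volterra g₀ u p)
    (hveq : ∀ p ∈ Ioo (0:ℝ) T ×ˢ Ω,
      ptime v p - Lop a b v p = f p (v p) + volterra g₀ v p)
    (hbdry : ∀ t ∈ Icc (0:ℝ) T, ∀ x ∈ frontier Ω, u (t, x) = v (t, x))
    (hinit : ∀ x ∈ closure Ω, u (0, x) = v (0, x)) :
    ∀ p ∈ Icc (0:ℝ) T ×ˢ closure Ω, u p = v p := by
  obtain ⟨r₁, hr₁⟩ := (isCompact_Icc.prod hΩb.isCompact_closure).exists_bound_of_continuousOn hucont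
  obtain ⟨r₂, hr₂⟩ := (isCompact_Icc.prod hΩb.isCompact_closure).exists_bound_of_continuousOn hvcont
  set r := max 1 (max r₁ r₂)
  have hur : ∀ p ∈ Icc (0:ℝ) T ×ˢ closure Ω, |u p| ≤ r := fun p hp =>
    (hr₁ p hp).trans ((le_max_left _ _).trans (le_max_right _ _))
  have hvr : ∀ p ∈ Icc (0:ℝ) T ×ˢ closure Ω, |v p| ≤ r := fun p hp =>
    (hr₂ p hp).trans ((le_max_right _ _).trans (le_max_right _ _))
  have hr0 : 0 < r := lt_max_of_lt_left one_pos
  obtain ⟨K, hK, hflip⟩ := hflip r hr0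
  obtain ⟨K₀, hK₀, hg₀lip⟩ := hg₀lip r hr0
  set l := K + 2 * K₀ * T + 1
  have hl0 : 0 ≤ l := by positivity
  have hlt : K + 2 * K₀ * T < l := lt_add_one _
  have hIco : ∀ t ∈ Ico 0 T, ∀ x ∈ closure Ω, u (t, x) = v (t, x) := fun t ht x hx => by
    have hsub : Icc 0 t ×ˢ closure Ω ⊆ Icc 0 T ×ˢ closure Ω :=
      prod_mono (Icc_subset_Icc_right ht.2.le) le_rfl
    have hcont : ContinuousOn (fun q : ℝ × (Fin N → ℝ) => Real.exp (-l * q.1) * |u q - v q|)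
        (Icc 0 t ×ˢ closure Ω) :=
      (by fun_prop : ContinuousOn (fun q : ℝ × (Fin N → ℝ) => Real.exp (-l * q.1)) _).mul
        ((hucont.mono hsub).sub (hvcont.mono hsub)).abs
    obtain ⟨p, hp, hmax⟩ := (isCompact_Icc.prod hΩb.isCompact_closure).exists_isMaxOn
      ⟨(t, x), ⟨ht.1, le_rfl⟩, hx⟩ hcont
    have hpeq : u p = v p := by
      by_cases hpD : p ∈ Ioo 0 T ×ˢ Ω
      · have hmax' : ∀ q ∈ Icc 0 p.1 ×ˢ closure Ω,
            Real.exp (-l * q.1) * |u q - v q| ≤ Real.exp (-l * p.1) * |u p - v p| :=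
          fun q hq => hmax ⟨⟨hq.1.1, hq.1.2.trans hp.1.2⟩, hq.2⟩
        refine le_antisymm ?_ ?_
        · exact sub_nonpos_of_weighted_max hΩo hsym hpos hK₀ hflip hg₀cont hg₀lip hucont hvcont
            hur hvr hu12 hv12 hueq hveq hlt hl0 hpD hmax'
        · refine sub_nonpos_of_weighted_max hΩo hsym hpos hK₀ hflip hg₀cont hg₀lip hvcont hucont
            hvr hur hv12 hu12 hveq hueq hlt hl0 hpD fun q hq => ?_
          simpa only [abs_sub_comm] using hmax' q hq
      · by_cases hpΩ : p.2 ∈ Ω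
        · have h0 : p.1 = 0 := by
            by_contra h
            exact hpD ⟨⟨lt_of_le_of_ne hp.1.1 (Ne.symm h), hp.1.2.trans_lt ht.2⟩, hpΩ⟩
          have := hinit p.2 hp.2
          rwa [← h0] at this
        · exact hbdry p.1 (hsub hp).1 p.2 (hΩo.frontier_eq ▸ ⟨hp.2, hpΩ⟩)
    have h := hmax (⟨⟨ht.1, le_rfl⟩, hx⟩ : (t, x) ∈ Icc 0 t ×ˢ closure Ω)
    simp only [mem_ofPred_eq, hpeq, sub_self, abs_zero, mul_zero] at h
    have h' : |u (t, x) - v (t, x)| ≤ 0 := by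
      by_contra! hpos'
      exact absurd h (mul_pos (Real.exp_pos _) hpos').not_ge
    exact sub_eq_zero.mp (abs_nonpos_iff.mp h')
  rintro ⟨t, x⟩ ⟨ht, hx⟩
  have hslice : ∀ {w : ℝ × (Fin N → ℝ) → ℝ}, ContinuousOn w (Icc 0 T ×ˢ closure Ω) →
      ContinuousOn (fun s => w (s, x)) (Icc 0 T) := fun hw =>
    hw.comp (by fun_prop) fun s hs => ⟨hs, hx⟩
  have heq : EqOn (fun s => u (s, x)) (fun s => v (s, x)) (Ico 0 T) := fun s hs => hIco s hs x hx
  exact heq.of_subset_closure (hslice hucont) (hslice hvcont) Ico_subset_Icc_self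
    (closure_Ico hT.ne).ge ht
end
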